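/- arXiv:2410.21544 — 2 statements merged into one kernel-verified Lean document; each statement's English description precedes it below -/
import Mathlib

section
/- Fix n ≥ 2 and a real constant h. Let U_1,…,U_n be continuously differentiable real-valued functions on the chamber 𝔜^n = {θ ∈ ℝ^n : θ_1 < θ_2 < … < θ_n < θ_1 + 2π} satisfying, for every j and every θ ∈ 𝔜^n, the null vector equation (1/2)U_j(θ)^2 + Σ_{k≠j} cot((θ_k−θ_j)/2)·U_k(θ) − Σ_{k≠j} 3/(2 sin^2((θ_j−θ_k)/2)) = h. Define the first-order operators (M_j ψ)(θ) = U_j(θ)·∂ψ/∂θ_j + Σ_{k≠j} cot((θ_k−θ_j)/2)·∂ψ/∂θ_k. Then for all i ≠ j, every twice continuously differentiable ψ : 𝔜^n → ℝ and every θ ∈ 𝔜^n, M_i(M_j ψ)(θ) − M_j(M_i ψ)(θ) = (1/sin^2((θ_i−θ_j)/2))·( (M_j ψ)(θ) − (M_i ψ)(θ) ). -/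
open Finset

/-- The angular chamber `𝔜^n = {θ : θ_1 < θ_2 < … < θ_n < θ_1 + 2π}`. -/
def chamber (n : ℕ) : Set (Fin n → ℝ) :=
  {θ | StrictMono θ ∧ ∀ i j : Fin n, θ i < θ j + 2 * Real.pi}

/-- Partial derivative in the `j`-th coordinate direction. -/
noncomputable def pd (n : ℕ) (j : Fin n) (ψ : (Fin n → ℝ) → ℝ) (θ : Fin n → ℝ) : ℝ :=
  fderiv ℝ ψ θ (Pi.single j 1 : Fin n → ℝ)

/-- The first-order operator `M_j = U_j ∂_j + Σ_{k≠j} cot((θ_k−θ_j)/2) ∂_k`. -/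
noncomputable def Mop (n : ℕ) (U : Fin n → (Fin n → ℝ) → ℝ) (j : Fin n)
    (ψ : (Fin n → ℝ) → ℝ) (θ : Fin n → ℝ) : ℝ :=
  U j θ * pd n j ψ θ
    + ∑ k ∈ univ.filter (fun k => k ≠ j),
        Real.cos ((θ k - θ j) / 2) / Real.sin ((θ k - θ j) / 2) * pd n k ψ θ

open Filter Topology

/-- Functions `F x p` which, for `x ∈ s` and `p ∈ Z x`, are combinations of squarefree monomials
in `p` with coefficients continuous in `x`. -/
def SquarefreeReducible {X ι : Type*} [TopologicalSpace X] [Fintype ι] (s : Set X)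
    (Z : X → Set (ι → ℝ)) (F : X → (ι → ℝ) → ℝ) : Prop :=
  ∃ a : Finset ι → X → ℝ, (∀ T, ContinuousOn (a T) s) ∧
    ∀ x ∈ s, ∀ p ∈ Z x, F x p = ∑ T, a T x * ∏ l ∈ T, p l

namespace SquarefreeReducible

variable {X ι : Type*} [TopologicalSpace X] [Fintype ι] {s : Set X}
  {Z : X → Set (ι → ℝ)} {F G : X → (ι → ℝ) → ℝ}

theorem congr (hF : SquarefreeReducible s Z F) (h : ∀ x ∈ s, ∀ p ∈ Z x, G x p = F x p) :
    SquarefreeReducible s Z G := by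
  obtain ⟨a, ha, hF⟩ := hF
  exact ⟨a, ha, fun x hx p hp => (h x hx p hp).trans (hF x hx p hp)⟩

theorem add (hF : SquarefreeReducible s Z F) (hG : SquarefreeReducible s Z G) :
    SquarefreeReducible s Z (fun x p => F x p + G x p) := by
  obtain ⟨a, ha, hF⟩ := hF
  obtain ⟨b, hb, hG⟩ := hG
  refine ⟨fun T x => a T x + b T x, fun T => (ha T).add (hb T), fun x hx p hp => ?_⟩
  simp only [hF x hx p hp, hG x hx p hp, add_mul, sum_add_distrib]

theorem const_mul {c : X → ℝ} (hc : ContinuousOn c s) (hF : SquarefreeReducible s Z F) :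
    SquarefreeReducible s Z (fun x p => c x * F x p) := by
  obtain ⟨a, ha, hF⟩ := hF
  refine ⟨fun T x => c x * a T x, fun T => hc.mul (ha T), fun x hx p hp => ?_⟩
  simp only [hF x hx p hp, mul_sum, mul_assoc]

theorem sum {κ : Type*} (t : Finset κ) {f : κ → X → (ι → ℝ) → ℝ}
    (hf : ∀ k ∈ t, SquarefreeReducible s Z (f k)) :
    SquarefreeReducible s Z (fun x p => ∑ k ∈ t, f k x p) := by
  classical
  induction t using Finset.induction_on with
  | empty => exact ⟨fun _ _ => 0, fun _ => continuousOn_const, by simp⟩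
  | insert k t hk ih =>
    refine ((hf k (mem_insert_self k t)).add
      (ih fun l hl => hf l (mem_insert_of_mem hl))).congr fun x _ p _ => ?_
    rw [sum_insert hk]

theorem monomial (T : Finset ι) : SquarefreeReducible s Z (fun _ p => ∏ l ∈ T, p l) := by
  classical
  refine ⟨fun T' _ => if T' = T then 1 else 0, fun _ => continuousOn_const, fun x _ p _ => ?_⟩
  simp

theorem coord_mul_monomial {b : ι → X → ℝ} {c : ι → ι → X → ℝ}
    (hb : ∀ k, ContinuousOn (b k) s) (hc : ∀ k l, ContinuousOn (c k l) s)
    (hZ : ∀ x ∈ s, ∀ p ∈ Z x, ∀ k, p k * p k = b k x + ∑ l, c k l x * p l)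
    (T : Finset ι) (k : ι) :
    SquarefreeReducible s Z (fun _ p => p k * ∏ l ∈ T, p l) := by
  classical
  induction hN : T.card using Nat.strong_induction_on generalizing T k with
  | _ N ih =>
    by_cases hk : k ∈ T
    · have hlt : (T.erase k).card < N := hN ▸ card_erase_lt_of_mem hk
      refine (((monomial (T.erase k)).const_mul (hb k)).add
        (sum univ fun l _ => (ih _ hlt (T.erase k) l rfl).const_mul (hc k l))).congr
        fun x hx p hp => ?_
      rw [← mul_prod_erase T p hk, ← mul_assoc, hZ x hx p hp k, add_mul, sum_mul]
      simp only [mul_assoc]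
    · refine (monomial (insert k T)).congr fun x _ p _ => ?_
      rw [prod_insert hk]

end SquarefreeReducible

theorem continuousOn_charpoly_coeff {X κ : Type*} [TopologicalSpace X] [Fintype κ]
    [DecidableEq κ] {s : Set X} {B : X → Matrix κ κ ℝ}
    (hB : ∀ i j, ContinuousOn (fun x => B x i j) s) (d : ℕ) :
    ContinuousOn (fun x => (B x).charpoly.coeff d) s := by
  have key : ∀ x, (B x).charpoly.coeff d =
      MvPolynomial.eval (fun ij : κ × κ => B x ij.1 ij.2)
        ((Matrix.charpoly.univ ℝ κ).coeff d) := fun x =>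
    (Matrix.charpoly.univ_coeff_eval₂Hom (n := κ) (RingHom.id ℝ)
      (fun ij : κ × κ => B x ij.1 ij.2) d).symm
  simp only [key]
  have hpi : ContinuousOn (fun x => fun ij : κ × κ => B x ij.1 ij.2) s :=
    continuousOn_pi.2 fun ij => hB ij.1 ij.2
  exact (MvPolynomial.continuous_eval _).comp_continuousOn hpi

/-- A continuous family of zeros of a finite system of quadrics with continuous coefficients is,
near the points of a dense set and coordinate by coordinate, locally the only family of zeros. -/
theorem exists_locally_unique_coord {X ι : Type*} [TopologicalSpace X] [Fintype ι]
    {s : Set X} (hs : IsOpen s) {Z : X → Set (ι → ℝ)} {b : ι → X → ℝ} {c : ι → ι → X → ℝ}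
    (hb : ∀ k, ContinuousOn (b k) s) (hc : ∀ k l, ContinuousOn (c k l) s)
    (hZ : ∀ x ∈ s, ∀ p ∈ Z x, ∀ k, p k * p k = b k x + ∑ l, c k l x * p l)
    (m : ι) {u : X → ℝ} (hu : ContinuousOn u s) (hne : s.Nonempty) :
    ∃ x₁ ∈ s, ∀ᶠ z : X × ℝ in 𝓝 (x₁, 0), ∀ p ∈ Z z.1, p m - u z.1 = z.2 → p m = u z.1 := by
  classical
  choose a ha hF using fun T =>
    SquarefreeReducible.coord_mul_monomial (Z := Z) hb hc hZ T m
  let B : X → Matrix (Finset ι) (Finset ι) ℝ := fun x =>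
    Matrix.of (fun S T => a S T x) - Matrix.scalar _ (u x)
  have hB : ∀ i j, ContinuousOn (fun x => B x i j) s := fun S T => by
    by_cases h : S = T
    · subst h
      simpa [B, Pi.sub_def] using (ha S S).sub hu
    · simpa [B, Matrix.diagonal_apply_ne _ h] using ha S T
  have hroot : ∀ x ∈ s, ∀ p ∈ Z x, (B x).charpoly.eval (p m - u x) = 0 := by
    intro x hx p hp
    rw [Matrix.eval_charpoly, ← Matrix.exists_mulVec_eq_zero_iff]
    refine ⟨fun T => ∏ l ∈ T, p l, fun h => ?_, ?_⟩
    · simpa using congrFun h ∅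
    · ext S
      have := hF S x hx p hp
      simp only [B, Matrix.sub_mulVec, Matrix.scalar_apply, Pi.sub_apply,
        Matrix.mulVec_diagonal, Pi.zero_apply]
      simp only [Matrix.mulVec, dotProduct, Matrix.of_apply, ← this]
      ring
  have hex : ∃ d, ∃ x ∈ s, (B x).charpoly.coeff d ≠ 0 := by
    obtain ⟨x, hx⟩ := hne
    exact ⟨_, x, hx, by rw [Polynomial.coeff_natDegree, (B x).charpoly_monic]; exact one_ne_zero⟩
  obtain ⟨x₁, hx₁, hd⟩ := Nat.find_spec hex
  have hlow : ∀ i < Nat.find hex, ∀ x ∈ s, (B x).charpoly.coeff i = 0 := fun i hi x hx => by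
    by_contra h
    exact Nat.find_min hex hi ⟨x, hx, h⟩
  set d := Nat.find hex
  set N := Fintype.card (Finset ι)
  have hsnd : ContinuousAt (fun z : X × ℝ => z.2) (x₁, 0) := continuousAt_snd
  have hg : ContinuousAt (fun z : X × ℝ =>
      ∑ i ∈ range (N + 1), (B z.1).charpoly.coeff (d + i) * z.2 ^ i) (x₁, 0) := by
    refine tendsto_finsetSum _ fun i _ => ?_
    refine ContinuousAt.mul ?_ (hsnd.pow i)
    exact ContinuousAt.comp (f := Prod.fst) (x := (x₁, (0 : ℝ)))
      ((continuousOn_charpoly_coeff hB (d + i)).continuousAt (hs.mem_nhds hx₁)) continuousAt_fst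
  have hg0 : (∑ i ∈ range (N + 1), (B x₁).charpoly.coeff (d + i) * (0 : ℝ) ^ i) ≠ 0 := by
    rw [sum_range_succ']
    simpa using hd
  refine ⟨x₁, hx₁, ?_⟩
  filter_upwards [hg.eventually_ne hg0,
    continuousAt_fst.preimage_mem_nhds (hs.mem_nhds hx₁)] with z hz hzs p hp hpz
  have h0 := hroot z.1 hzs p hp
  rw [hpz, Polynomial.eval_eq_sum_range' (n := d + (N + 1)), sum_range_add,
    sum_eq_zero fun i hi => ?_, zero_add] at h0
  · simp only [pow_add, mul_left_comm _ (z.2 ^ d)] at h0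
    rw [← mul_sum] at h0
    have := eq_zero_of_pow_eq_zero ((mul_eq_zero.1 h0).resolve_right hz)
    linarith
  · rw [hlow i (mem_range.1 hi) z.1 hzs, zero_mul]
  · rw [Matrix.charpoly_natDegree_eq_dim]
    omega

/-- `cotHalf x = cot (x / 2)`, with the value `0` at the poles. -/
noncomputable def cotHalf (x : ℝ) : ℝ := Real.cos (x / 2) / Real.sin (x / 2)

theorem cotHalf_zero : cotHalf 0 = 0 := by simp [cotHalf]

theorem cotHalf_neg (x : ℝ) : cotHalf (-x) = -cotHalf x := by
  simp [cotHalf, neg_div, div_neg]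

theorem cotHalf_sub_comm (x y : ℝ) : cotHalf (x - y) = -cotHalf (y - x) := by
  rw [← cotHalf_neg, neg_sub]

theorem one_add_cotHalf_sq {x : ℝ} (hx : Real.sin (x / 2) ≠ 0) :
    1 + cotHalf x ^ 2 = 1 / Real.sin (x / 2) ^ 2 := by
  rw [cotHalf]
  field_simp
  exact Real.sin_sq_add_cos_sq _

theorem hasDerivAt_cotHalf {x : ℝ} (hx : Real.sin (x / 2) ≠ 0) :
    HasDerivAt cotHalf (-(1 + cotHalf x ^ 2) / 2) x := by
  have h2 : HasDerivAt (fun y : ℝ => y / 2) (1 / 2) x := (hasDerivAt_id x).div_const 2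
  refine (h2.cos.fun_div h2.sin hx).congr_deriv ?_
  unfold cotHalf
  field_simp
  ring

theorem contDiffAt_cotHalf {x : ℝ} (hx : Real.sin (x / 2) ≠ 0) {k : WithTop ℕ∞} :
    ContDiffAt ℝ k cotHalf x := by
  unfold cotHalf
  exact ContDiffAt.div (Real.contDiff_cos.contDiffAt.comp x (contDiffAt_id.div_const 2))
    (Real.contDiff_sin.contDiffAt.comp x (contDiffAt_id.div_const 2)) hx

theorem cotHalf_addition {x y z : ℝ} (hzx : Real.sin ((z - x) / 2) ≠ 0)
    (hzy : Real.sin ((z - y) / 2) ≠ 0) (hyx : Real.sin ((y - x) / 2) ≠ 0) :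
    (cotHalf (z - y) - cotHalf (z - x)) * cotHalf (y - x)
      = 1 + cotHalf (z - x) * cotHalf (z - y) := by
  have e : (z - x) / 2 = (z - y) / 2 + (y - x) / 2 := by ring
  unfold cotHalf
  rw [e] at hzx ⊢
  generalize (z - y) / 2 = a at *
  generalize (y - x) / 2 = b at *
  field_simp
  rw [Real.sin_add, Real.cos_add]
  ring

variable {n : ℕ}

theorem sin_half_sub_ne_zero {θ : Fin n → ℝ} (hθ : θ ∈ chamber n) {k j : Fin n} (h : k ≠ j) :
    Real.sin ((θ k - θ j) / 2) ≠ 0 := by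
  have h1 := hθ.2 k j
  have h2 := hθ.2 j k
  rcases lt_or_gt_of_ne h with hl | hl
  · have := hθ.1 hl
    exact (Real.sin_neg_of_neg_of_neg_pi_lt (by linarith) (by linarith)).ne
  · have := hθ.1 hl
    exact (Real.sin_pos_of_pos_of_lt_pi (by linarith) (by linarith)).ne'

theorem isOpen_chamber : IsOpen (chamber n) := by
  have : chamber n = (⋂ i : Fin n, ⋂ j : Fin n, {θ | i < j → θ i < θ j}) ∩
      ⋂ i : Fin n, ⋂ j : Fin n, {θ | θ i < θ j + 2 * Real.pi} := by
    ext θ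
    simp [chamber, StrictMono]
  rw [this]
  refine IsOpen.inter (isOpen_iInter_of_finite fun i => isOpen_iInter_of_finite fun j => ?_)
    (isOpen_iInter_of_finite fun i => isOpen_iInter_of_finite fun j => ?_)
  · by_cases h : i < j
    · simpa [h] using isOpen_lt (continuous_apply i) (continuous_apply j)
    · simp [h]
  · exact isOpen_lt (continuous_apply i) ((continuous_apply j).add continuous_const)

/-- The Hamiltonian whose level sets are given by the `j`-th null vector equation, up to an
additive constant. -/
noncomputable def nullHam (j : Fin n) (θ p : Fin n → ℝ) : ℝ :=
  p j ^ 2 / 2 + ∑ k, (cotHalf (θ k - θ j) * p k - 3 / 2 * cotHalf (θ k - θ j) ^ 2)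

/-- The `p`-gradient of `nullHam j`. -/
noncomputable def velocity (j : Fin n) (θ p : Fin n → ℝ) (k : Fin n) : ℝ :=
  cotHalf (θ k - θ j) + if k = j then p j else 0

/-- The force on `θ k` from the interaction with `θ j` in `nullHam j`. -/
noncomputable def pairForce (j : Fin n) (θ p : Fin n → ℝ) (k : Fin n) : ℝ :=
  (1 + cotHalf (θ k - θ j) ^ 2) / 2 * (p k - 3 * cotHalf (θ k - θ j))

/-- Minus the `θ`-gradient of `nullHam j`. -/
noncomputable def force (j : Fin n) (θ p : Fin n → ℝ) (k : Fin n) : ℝ :=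
  pairForce j θ p k - if k = j then ∑ l, pairForce j θ p l else 0

theorem hasDerivAt_nullHam {θ p : ℝ → Fin n → ℝ} {v f : Fin n → ℝ} {t : ℝ}
    (hθ : HasDerivAt θ v t) (hp : HasDerivAt p f t) (ht : θ t ∈ chamber n) (i : Fin n) :
    HasDerivAt (fun s => nullHam i (θ s) (p s))
      (p t i * f i + ∑ k, (-pairForce i (θ t) (p t) k * (v k - v i)
        + cotHalf (θ t k - θ t i) * f k)) t := by
  have hθ' := hasDerivAt_pi.1 hθ
  have hp' := hasDerivAt_pi.1 hp
  unfold nullHam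
  refine HasDerivAt.fun_add ?_ (HasDerivAt.fun_sum fun k _ => ?_)
  · refine (((hp' i).fun_pow 2).div_const 2).congr_deriv ?_
    ring
  · have hc : HasDerivAt (fun s => cotHalf (θ s k - θ s i))
        (-(1 + cotHalf (θ t k - θ t i) ^ 2) / 2 * (v k - v i)) t := by
      by_cases h : k = i
      · subst h
        simpa using hasDerivAt_const t (cotHalf 0)
      · exact (hasDerivAt_cotHalf (sin_half_sub_ne_zero ht h)).comp t ((hθ' k).sub (hθ' i))
    refine ((hc.mul (hp' k)).fun_sub ((hc.fun_pow 2).const_mul (3 / 2))).congr_deriv ?_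
    rw [pairForce]
    push_cast
    ring

theorem velocity_of_ne {i j : Fin n} (h : i ≠ j) (θ p : Fin n → ℝ) :
    velocity j θ p i = cotHalf (θ i - θ j) := by simp [velocity, h]

theorem force_of_ne {i j : Fin n} (h : i ≠ j) (θ p : Fin n → ℝ) :
    force j θ p i = pairForce j θ p i := by simp [force, h]

theorem nullHam_bracket_self (θ p : Fin n → ℝ) (j : Fin n) :
    p j * force j θ p j + ∑ k, (-pairForce j θ p k * (velocity j θ p k - velocity j θ p j)
        + cotHalf (θ k - θ j) * force j θ p k) = 0 := by
  have term : ∀ k, -pairForce j θ p k * (velocity j θ p k - velocity j θ p j)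
        + cotHalf (θ k - θ j) * force j θ p k
      = p j * pairForce j θ p k - if k = j then p j * pairForce j θ p j else 0 := by
    intro k
    by_cases h : k = j
    · subst h
      simp [cotHalf_zero]
    · simp only [velocity, force, h, if_false, if_true, sub_self, cotHalf_zero]
      ring
  simp only [term, sum_sub_distrib, ← mul_sum, sum_ite_eq', mem_univ, if_true]
  simp only [force, if_true]
  ring

/-- The Poisson bracket of two of the null vector Hamiltonians. -/
theorem nullHam_bracket {θ p : Fin n → ℝ} (hθ : θ ∈ chamber n) {i j : Fin n} (hij : i ≠ j) :
    p i * force j θ p i + ∑ k, (-pairForce i θ p k * (velocity j θ p k - velocity j θ p i)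
        + cotHalf (θ k - θ i) * force j θ p k)
      = (1 + cotHalf (θ j - θ i) ^ 2) * (nullHam i θ p - nullHam j θ p) := by
  set c := cotHalf (θ j - θ i) with hc
  have hc' : cotHalf (θ i - θ j) = -c := cotHalf_sub_comm _ _
  have hji := hij.symm
  have term : ∀ k, -pairForce i θ p k * (velocity j θ p k - velocity j θ p i)
        + cotHalf (θ k - θ i) * force j θ p k
      = (1 + c ^ 2) * ((cotHalf (θ k - θ i) * p k - 3 / 2 * cotHalf (θ k - θ i) ^ 2)
          - (cotHalf (θ k - θ j) * p k - 3 / 2 * cotHalf (θ k - θ j) ^ 2))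
        + c * pairForce j θ p k
        + (if k = i then -(1 + c ^ 2) * (c * p i + 3 / 2 * c ^ 2) - c * pairForce j θ p i else 0)
        + (if k = j then -pairForce i θ p j * (p j + c) - (1 + c ^ 2) * (c * p j - 3 / 2 * c ^ 2)
            - c * ∑ l, pairForce j θ p l else 0) := by
    intro k
    rw [velocity_of_ne hij, hc']
    by_cases hki : k = i
    · subst hki
      rw [velocity_of_ne hij]
      simp only [hij, if_false, if_true, sub_self, cotHalf_zero, hc']
      ring
    by_cases hkj : k = j
    · subst hkj
      simp only [velocity, force, hki, if_false, if_true, sub_self, cotHalf_zero, ← hc]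
      ring
    rw [velocity_of_ne hkj, force_of_ne hkj]
    simp only [hki, hkj, if_false, pairForce]
    have add := cotHalf_addition (sin_half_sub_ne_zero hθ hki) (sin_half_sub_ne_zero hθ hkj)
      (sin_half_sub_ne_zero hθ hji)
    rw [← hc] at add
    generalize cotHalf (θ k - θ i) = a at *
    generalize cotHalf (θ k - θ j) = b at *
    linear_combination
      (p k / 2 * (2 * c - b + a) + 3 / 2 * (a + b) * (b - a - c)) * add
  simp only [term, sum_add_distrib, ← mul_sum, sum_sub_distrib, sum_ite_eq', mem_univ, if_true,
    force_of_ne hij, nullHam]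
  simp only [pairForce, ← hc, hc']
  ring

theorem contDiffAt_cotHalf_sub {E : Type*} [NormedAddCommGroup E] [NormedSpace ℝ E]
    {g : E → Fin n → ℝ} {x : E} {r : WithTop ℕ∞} (hg : ContDiffAt ℝ r g x)
    (hx : g x ∈ chamber n) (k j : Fin n) :
    ContDiffAt ℝ r (fun y => cotHalf (g y k - g y j)) x := by
  by_cases h : k = j
  · subst h
    simpa using contDiffAt_const
  · have hg' := contDiffAt_pi.1 hg
    exact (contDiffAt_cotHalf (sin_half_sub_ne_zero hx h)).comp x ((hg' k).sub (hg' j))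

theorem contDiffAt_velocity {E : Type*} [NormedAddCommGroup E] [NormedSpace ℝ E]
    {g u : E → Fin n → ℝ} {x : E} {r : WithTop ℕ∞} (hg : ContDiffAt ℝ r g x)
    (hu : ContDiffAt ℝ r u x) (hx : g x ∈ chamber n) (j : Fin n) :
    ContDiffAt ℝ r (fun y => velocity j (g y) (u y)) x := by
  refine contDiffAt_pi.2 fun k => ?_
  refine (contDiffAt_cotHalf_sub hg hx k j).add ?_
  by_cases h : k = j
  · simpa [h] using contDiffAt_pi.1 hu j
  · simpa [h] using contDiffAt_const

theorem contDiffAt_force {E : Type*} [NormedAddCommGroup E] [NormedSpace ℝ E]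
    {g u : E → Fin n → ℝ} {x : E} {r : WithTop ℕ∞} (hg : ContDiffAt ℝ r g x)
    (hu : ContDiffAt ℝ r u x) (hx : g x ∈ chamber n) (j : Fin n) :
    ContDiffAt ℝ r (fun y => force j (g y) (u y)) x := by
  have hq : ∀ k, ContDiffAt ℝ r (fun y => pairForce j (g y) (u y) k) x := fun k => by
    have hc := contDiffAt_cotHalf_sub hg hx k j
    exact ((contDiffAt_const.add (hc.pow 2)).div_const 2).mul
      ((contDiffAt_pi.1 hu k).sub (contDiffAt_const.mul hc))
  refine contDiffAt_pi.2 fun k => (hq k).sub ?_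
  by_cases h : k = j
  · simpa [h] using ContDiffAt.sum fun l _ => hq l
  · simpa [h] using contDiffAt_const

/-- The common level sets of the Hamiltonians `nullHam i` are invariant under the Hamiltonian flow
of each of them. -/
theorem nullHam_eq_of_flow {θ p : ℝ → Fin n → ℝ} {j : Fin n} {δ h : ℝ}
    (hθ : ∀ t ∈ Set.Icc 0 δ, HasDerivAt θ (velocity j (θ t) (p t)) t)
    (hp : ∀ t ∈ Set.Icc 0 δ, HasDerivAt p (force j (θ t) (p t)) t)
    (hmem : ∀ t ∈ Set.Icc 0 δ, θ t ∈ chamber n)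
    (h0 : ∀ i, nullHam i (θ 0) (p 0) = h) :
    ∀ t ∈ Set.Icc 0 δ, ∀ i, nullHam i (θ t) (p t) = h := by
  have hder := fun t ht i => hasDerivAt_nullHam (hθ t ht) (hp t ht) (hmem t ht) i
  have hj : ∀ t ∈ Set.Icc 0 δ, nullHam j (θ t) (p t) - h = 0 := by
    refine eq_zero_of_abs_deriv_le_mul_abs_self_of_eq_zero_right (K := 0) (f' := fun _ => 0)
      (fun t ht => ((hder t ht j).sub_const h).continuousAt.continuousWithinAt)
      (fun t ht => ?_) (by simp [h0]) (by simp)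
    have := (hder t (Set.Ico_subset_Icc_self ht) j).sub_const h
    rw [nullHam_bracket_self] at this
    exact this.hasDerivWithinAt
  intro t ht i
  by_cases hij : i = j
  · subst hij
    linarith [hj t ht]
  have hcont : ContinuousOn (fun t => 1 + cotHalf (θ t j - θ t i) ^ 2) (Set.Icc 0 δ) := by
    intro t ht
    have h1 : ContinuousAt (fun y : Fin n → ℝ => cotHalf (y j - y i)) (θ t) :=
      (contDiffAt_cotHalf_sub (r := 1) contDiffAt_id (hmem t ht) j i).continuousAt
    have h2 : ContinuousAt (fun t => cotHalf (θ t j - θ t i)) t :=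
      ContinuousAt.comp (f := θ) h1 (hθ t ht).continuousAt
    exact (continuousAt_const.add (h2.pow 2)).continuousWithinAt
  obtain ⟨K, hK⟩ := isCompact_Icc.exists_bound_of_continuousOn hcont
  have := eq_zero_of_abs_deriv_le_mul_abs_self_of_eq_zero_right (a := 0) (b := δ) (K := K)
    (f := fun t => nullHam i (θ t) (p t) - h)
    (f' := fun t => (1 + cotHalf (θ t j - θ t i) ^ 2) * (nullHam i (θ t) (p t) - h))
    (fun t ht => ((hder t ht i).sub_const h).continuousAt.continuousWithinAt)
    (fun t ht => ?_) (by simp [h0]) (fun t ht => ?_) t ht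
  · linarith
  · have ht' := Set.Ico_subset_Icc_self ht
    have := (hder t ht' i).sub_const h
    rw [nullHam_bracket (hmem t ht') hij, sub_eq_zero.1 (hj t ht')] at this
    exact this.hasDerivWithinAt
  · rw [norm_mul]
    exact mul_le_mul_of_nonneg_right (hK t (Set.Ico_subset_Icc_self ht)) (norm_nonneg _)

/-- A point near which the graph of `U` is, in the coordinate `m`, all of the common level set:
there the graph of `U m` is tangent to the Hamiltonian flows. -/
theorem fderiv_velocity_of_locally_unique {U : (Fin n → ℝ) → Fin n → ℝ} {h : ℝ}
    {x : Fin n → ℝ} (hx : x ∈ chamber n) (hU : DifferentiableAt ℝ U x)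
    (hlevel : ∀ i, nullHam i x (U x) = h) (j m : Fin n)
    (huniq : ∀ᶠ z : (Fin n → ℝ) × ℝ in 𝓝 (x, 0), ∀ p, (∀ i, nullHam i z.1 p = h) →
      p m - U z.1 m = z.2 → p m = U z.1 m) :
    fderiv ℝ U x (velocity j x (U x)) m = force j x (U x) m := by
  have hX : ContDiffAt ℝ 1 (fun z : (Fin n → ℝ) × (Fin n → ℝ) =>
      (velocity j z.1 z.2, force j z.1 z.2)) (x, U x) :=
    (contDiffAt_velocity contDiffAt_fst contDiffAt_snd hx j).prodMk
      (contDiffAt_force contDiffAt_fst contDiffAt_snd hx j)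
  obtain ⟨α, hα0, ε, hε, hα⟩ :=
    hX.exists_forall_mem_closedBall_exists_eq_forall_mem_Ioo_hasDerivAt₀ 0
  have hfst : ∀ t ∈ Set.Ioo (0 - ε) (0 + ε), HasDerivAt (fun s => (α s).1)
      (velocity j (α t).1 (α t).2) t := fun t ht => (hα t ht).fst
  have hsnd : ∀ t ∈ Set.Ioo (0 - ε) (0 + ε), HasDerivAt (fun s => (α s).2)
      (force j (α t).1 (α t).2) t := fun t ht => (hα t ht).snd
  have h0 : (0 : ℝ) ∈ Set.Ioo (0 - ε) (0 + ε) := by simp [hε]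
  have hf0 := hfst 0 h0
  have hs0 := hsnd 0 h0
  rw [hα0] at hf0 hs0
  have hU' : HasFDerivAt U (fderiv ℝ U x) (α 0).1 := by rw [hα0]; exact hU.hasFDerivAt
  have hUα := hasDerivAt_pi.1 (hU'.comp_hasDerivAt 0 hf0) m
  have hpα := hasDerivAt_pi.1 hs0 m
  have hcont : Tendsto (fun t => ((α t).1, (α t).2 m - U (α t).1 m)) (𝓝 0) (𝓝 (x, 0)) := by
    have h1 := hf0.continuousAt.prodMk (hpα.sub hUα).continuousAt
    have h2 : ((α 0).1, (α 0).2 m - U (α 0).1 m) = (x, 0) := by simp [hα0]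
    rw [← h2]
    exact h1
  have hchamber : ∀ᶠ t in 𝓝 (0 : ℝ), (α t).1 ∈ chamber n :=
    hf0.continuousAt (isOpen_chamber.mem_nhds (by simpa [hα0] using hx))
  obtain ⟨δ, hδ, hball⟩ := Metric.eventually_nhds_iff_ball.1
    (hchamber.and ((eventually_mem_set.2 (Ioo_mem_nhds h0.1 h0.2)).and
      (hcont.eventually huniq)))
  have hIcc : ∀ t ∈ Set.Icc 0 (δ / 2), t ∈ Metric.ball (0 : ℝ) δ := fun t ht => by
    rw [Metric.mem_ball, Real.dist_eq, sub_zero, abs_of_nonneg ht.1]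
    linarith [ht.2]
  have hlev := nullHam_eq_of_flow (h := h) (δ := δ / 2) (j := j)
    (θ := fun t => (α t).1) (p := fun t => (α t).2)
    (fun t ht => hfst t (hball t (hIcc t ht)).2.1) (fun t ht => hsnd t (hball t (hIcc t ht)).2.1)
    (fun t ht => (hball t (hIcc t ht)).1) (by simpa [hα0] using hlevel)
  have heq : ∀ t ∈ Set.Icc 0 (δ / 2), (α t).2 m = U (α t).1 m := fun t ht =>
    (hball t (hIcc t ht)).2.2 _ (hlev t ht) rfl
  have hδ2 : 0 < δ / 2 := by linarith
  exact (uniqueDiffOn_Icc hδ2 0 ⟨le_rfl, hδ2.le⟩).eq_deriv _ hUα.hasDerivWithinAt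
    (hpα.hasDerivWithinAt.congr (fun t ht => (heq t ht).symm) (heq 0 ⟨le_rfl, hδ2.le⟩).symm)

/-- The graph of a `C¹` solution of the null vector equations is tangent to the Hamiltonian flows:
`U` restricted to an orbit solves the momentum equation. -/
theorem fderiv_velocity_eq_force {U : (Fin n → ℝ) → Fin n → ℝ} {h : ℝ}
    (hU : ContDiffOn ℝ 1 U (chamber n))
    (hlevel : ∀ x ∈ chamber n, ∀ i, nullHam i x (U x) = h) (j m : Fin n)
    {x : Fin n → ℝ} (hx : x ∈ chamber n) :
    fderiv ℝ U x (velocity j x (U x)) m = force j x (U x) m := by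
  have hUat : ∀ y ∈ chamber n, ContDiffAt ℝ 1 U y := fun y hy =>
    hU.contDiffAt (isOpen_chamber.mem_nhds hy)
  have hl : ContinuousOn (fun y => fderiv ℝ U y (velocity j y (U y)) m) (chamber n) := fun y hy => by
    have h1 : ContinuousAt (fderiv ℝ U) y :=
      ((hUat y hy).fderiv_right (m := 0) (by simp)).continuousAt
    have h2 := (contDiffAt_velocity contDiffAt_id (hUat y hy) hy j).continuousAt
    exact (continuousAt_pi.1 (h1.clm_apply h2) m).continuousWithinAt
  have hr : ContinuousOn (fun y => force j y (U y) m) (chamber n) := fun y hy =>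
    (continuousAt_pi.1 (contDiffAt_force contDiffAt_id (hUat y hy) hy j).continuousAt
      m).continuousWithinAt
  by_contra hne
  let s := chamber n ∩ {y | fderiv ℝ U y (velocity j y (U y)) m ≠ force j y (U y) m}
  have hs : IsOpen s := by
    have : s = chamber n ∩ (fun y => fderiv ℝ U y (velocity j y (U y)) m - force j y (U y) m) ⁻¹'
        {0}ᶜ := by
      ext y
      simp [s, sub_eq_zero]
    rw [this]
    exact (hl.sub hr).isOpen_inter_preimage isOpen_chamber isOpen_compl_singleton
  have hcot : ∀ k l : Fin n, ContinuousOn (fun y : Fin n → ℝ => cotHalf (y l - y k)) s :=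
    fun k l y hy => (contDiffAt_cotHalf_sub (r := 1) contDiffAt_id hy.1
      l k).continuousAt.continuousWithinAt
  have hquad : ∀ y ∈ s, ∀ p ∈ {p | ∀ i, nullHam i y p = h}, ∀ k,
      p k * p k = 2 * (h + ∑ l, 3 / 2 * cotHalf (y l - y k) ^ 2)
        + ∑ l, -2 * cotHalf (y l - y k) * p l := by
    intro y _ p hp k
    have hk := hp k
    rw [nullHam, sum_sub_distrib] at hk
    simp only [mul_assoc, ← mul_sum] at hk ⊢
    linear_combination 2 * hk
  obtain ⟨y, hy, huniq⟩ := exists_locally_unique_coord hs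
    (fun k => continuousOn_const.mul (continuousOn_const.add (continuousOn_finsetSum _
      fun l _ => continuousOn_const.mul ((hcot k l).pow 2))))
    (fun k l => continuousOn_const.mul (hcot k l)) hquad m
    (continuousOn_pi.1 (hU.continuousOn.mono Set.inter_subset_left) m) ⟨x, hx, hne⟩
  exact hy.2 (fderiv_velocity_of_locally_unique hy.1
    ((hUat y hy.1).differentiableAt one_ne_zero) (hlevel y hy.1) j m huniq)

theorem Mop_eq_fderiv_velocity (U : Fin n → (Fin n → ℝ) → ℝ) (j : Fin n)
    (ψ : (Fin n → ℝ) → ℝ) (θ : Fin n → ℝ) :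
    Mop n U j ψ θ = fderiv ℝ ψ θ (velocity j θ fun k => U k θ) := by
  have hlin : ∀ v : Fin n → ℝ, fderiv ℝ ψ θ v = ∑ k, v k * pd n k ψ θ := fun v => by
    conv_lhs => rw [pi_eq_sum_univ' v]
    simp only [map_sum, map_smul, smul_eq_mul, pd]
  rw [hlin, Mop, filter_ne', ← add_sum_erase _ _ (mem_univ j)]
  refine congrArg₂ _ (by simp [velocity, cotHalf_zero]) (sum_congr rfl fun k hk => ?_)
  rw [velocity_of_ne (ne_of_mem_erase hk), cotHalf]

/-- The commutator of two directional differentiation operators. -/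
theorem fderiv_fderiv_apply_sub {E : Type*} [NormedAddCommGroup E] [NormedSpace ℝ E]
    {ψ : E → ℝ} {V W : E → E} {x : E} (hψ : ContDiffAt ℝ 2 ψ x)
    (hV : DifferentiableAt ℝ V x) (hW : DifferentiableAt ℝ W x) :
    fderiv ℝ (fun y => fderiv ℝ ψ y (W y)) x (V x)
        - fderiv ℝ (fun y => fderiv ℝ ψ y (V y)) x (W x)
      = fderiv ℝ ψ x (fderiv ℝ W x (V x) - fderiv ℝ V x (W x)) := by
  have hd : DifferentiableAt ℝ (fderiv ℝ ψ) x :=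
    (hψ.fderiv_right (m := 1) (by norm_num)).differentiableAt one_ne_zero
  have hsymm := hψ.isSymmSndFDerivAt (by simp) (V x) (W x)
  rw [(hd.hasFDerivAt.clm_apply hV.hasFDerivAt).fderiv,
    (hd.hasFDerivAt.clm_apply hW.hasFDerivAt).fderiv]
  simp only [_root_.add_apply, ContinuousLinearMap.comp_apply,
    ContinuousLinearMap.flip_apply, map_sub, hsymm]
  ring

theorem fderiv_cotHalf_sub {θ : Fin n → ℝ} (hθ : θ ∈ chamber n) (k j : Fin n) (v : Fin n → ℝ) :
    fderiv ℝ (fun y : Fin n → ℝ => cotHalf (y k - y j)) θ v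
      = -(1 + cotHalf (θ k - θ j) ^ 2) / 2 * (v k - v j) := by
  by_cases h : k = j
  · subst h
    simp
  · have h1 : HasFDerivAt (fun y : Fin n → ℝ => y k - y j)
        (ContinuousLinearMap.proj k - ContinuousLinearMap.proj j : (Fin n → ℝ) →L[ℝ] ℝ) θ :=
      (hasFDerivAt_apply k θ).sub (hasFDerivAt_apply j θ)
    have h2 := (hasDerivAt_cotHalf (sin_half_sub_ne_zero hθ h)).comp_hasFDerivAt θ h1
    have h3 := h2.fderiv
    rw [Function.comp_def] at h3
    rw [h3]
    simp

theorem fderiv_apply_eq_fderiv_coord {ι E : Type*} [Fintype ι] [NormedAddCommGroup E]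
    [NormedSpace ℝ E] {V : E → ι → ℝ} {x : E} (hV : DifferentiableAt ℝ V x) (v : E) (k : ι) :
    fderiv ℝ V x v k = fderiv ℝ (fun y => V y k) x v := by
  rw [(hasFDerivAt_pi'.1 hV.hasFDerivAt k).fderiv]
  rfl

theorem fderiv_velocity_apply {U : (Fin n → ℝ) → Fin n → ℝ} {θ : Fin n → ℝ}
    (hθ : θ ∈ chamber n) (hU : ContDiffAt ℝ 1 U θ) (j k : Fin n) (v : Fin n → ℝ) :
    fderiv ℝ (fun y => velocity j y (U y)) θ v k
      = -(1 + cotHalf (θ k - θ j) ^ 2) / 2 * (v k - v j)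
        + if k = j then fderiv ℝ U θ v j else 0 := by
  have hV : DifferentiableAt ℝ (fun y => velocity j y (U y)) θ :=
    (contDiffAt_velocity contDiffAt_id hU hθ j).differentiableAt one_ne_zero
  have hUd := hU.differentiableAt one_ne_zero
  rw [← fderiv_cotHalf_sub hθ, fderiv_apply_eq_fderiv_coord hV]
  have hc := (contDiffAt_cotHalf_sub (r := 1) (contDiffAt_id (x := θ)) hθ k j).differentiableAt
    one_ne_zero
  by_cases h : k = j
  · subst h
    simp only [velocity, if_true, id] at hc ⊢
    rw [fderiv_fun_add hc (differentiableAt_pi.1 hUd k), fderiv_apply_eq_fderiv_coord hUd]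
    rfl
  · simp [velocity, h]

/-- The commutator of the velocity fields along a solution of the null vector equations. -/
theorem velocity_commutator {U : (Fin n → ℝ) → Fin n → ℝ} {h : ℝ}
    (hU : ContDiffOn ℝ 1 U (chamber n))
    (hlevel : ∀ x ∈ chamber n, ∀ i, nullHam i x (U x) = h) {i j : Fin n} (hij : i ≠ j)
    {θ : Fin n → ℝ} (hθ : θ ∈ chamber n) :
    fderiv ℝ (fun y => velocity j y (U y)) θ (velocity i θ (U θ))
        - fderiv ℝ (fun y => velocity i y (U y)) θ (velocity j θ (U θ))
      = (1 + cotHalf (θ i - θ j) ^ 2) • (velocity j θ (U θ) - velocity i θ (U θ)) := by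
  have hUθ := hU.contDiffAt (isOpen_chamber.mem_nhds hθ)
  have hij' := cotHalf_sub_comm (θ j) (θ i)
  ext m
  rw [Pi.sub_apply, fderiv_velocity_apply hθ hUθ, fderiv_velocity_apply hθ hUθ,
    fderiv_velocity_eq_force hU hlevel i j hθ, fderiv_velocity_eq_force hU hlevel j i hθ,
    force_of_ne hij, force_of_ne hij.symm, Pi.smul_apply, Pi.sub_apply, smul_eq_mul]
  by_cases hmi : m = i
  · subst hmi
    simp only [velocity, pairForce, hij, hij.symm, if_true, if_false, sub_self, cotHalf_zero, hij']
    ring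
  by_cases hmj : m = j
  · subst hmj
    simp only [velocity, pairForce, hij, hij.symm, if_true, if_false, sub_self, cotHalf_zero, hij']
    ring
  simp only [velocity, hmi, hmj, hij, hij.symm, if_false, add_zero, hij']
  have add := cotHalf_addition (sin_half_sub_ne_zero hθ hmj) (sin_half_sub_ne_zero hθ hmi)
    (sin_half_sub_ne_zero hθ hij)
  generalize cotHalf (θ m - θ i) = a at *
  generalize cotHalf (θ m - θ j) = b at *
  generalize cotHalf (θ i - θ j) = c at *
  linear_combination (2 * c - a + b) / 2 * add

theorem nullHam_eq_of_nullVector {j : Fin n} {θ p : Fin n → ℝ} {h : ℝ} (hθ : θ ∈ chamber n)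
    (hnv : (1 / 2) * p j ^ 2
        + ∑ k ∈ univ.filter (fun k => k ≠ j),
            Real.cos ((θ k - θ j) / 2) / Real.sin ((θ k - θ j) / 2) * p k
        - ∑ k ∈ univ.filter (fun k => k ≠ j),
            3 / (2 * Real.sin ((θ j - θ k) / 2) ^ 2) = h) :
    nullHam j θ p = h + 3 / 2 * ((n : ℝ) - 1) := by
  have hsin : ∀ k ∈ univ.erase j, 3 / (2 * Real.sin ((θ j - θ k) / 2) ^ 2)
      = 3 / 2 * cotHalf (θ k - θ j) ^ 2 + 3 / 2 := fun k hk => by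
    have hk' := one_add_cotHalf_sq (sin_half_sub_ne_zero hθ (ne_of_mem_erase hk))
    have hs : Real.sin ((θ j - θ k) / 2) ^ 2 = Real.sin ((θ k - θ j) / 2) ^ 2 := by
      rw [← neg_sub, neg_div, Real.sin_neg, neg_sq]
    rw [hs, ← div_div, div_eq_mul_one_div (3 / 2), ← hk']
    ring
  have hn : ((univ.erase j).card : ℝ) = n - 1 := by
    rw [cast_card_erase_of_mem (mem_univ j), card_univ, Fintype.card_fin]
  rw [filter_ne', sum_congr rfl hsin, sum_add_distrib, sum_const, nsmul_eq_mul, hn] at hnv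
  rw [nullHam, ← add_sum_erase _ _ (mem_univ j), sum_sub_distrib, sub_self, cotHalf_zero]
  change _ + ∑ k ∈ univ.erase j, cotHalf (θ k - θ j) * p k - _ = h at hnv
  linear_combination hnv

theorem stmt16 (n : ℕ) (hn : 2 ≤ n) (h : ℝ)
    (U : Fin n → (Fin n → ℝ) → ℝ)
    (hU : ∀ j, ContDiffOn ℝ 1 (U j) (chamber n))
    (hnv : ∀ j : Fin n, ∀ θ ∈ chamber n,
      (1 / 2) * U j θ ^ 2
        + ∑ k ∈ univ.filter (fun k => k ≠ j),
            Real.cos ((θ k - θ j) / 2) / Real.sin ((θ k - θ j) / 2) * U k θ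
        - ∑ k ∈ univ.filter (fun k => k ≠ j),
            3 / (2 * Real.sin ((θ j - θ k) / 2) ^ 2) = h)
    (i j : Fin n) (hij : i ≠ j)
    (ψ : (Fin n → ℝ) → ℝ) (hψ : ContDiffOn ℝ 2 ψ (chamber n))
    (θ : Fin n → ℝ) (hθ : θ ∈ chamber n) :
    Mop n U i (Mop n U j ψ) θ - Mop n U j (Mop n U i ψ) θ
      = (1 / Real.sin ((θ i - θ j) / 2) ^ 2) * (Mop n U j ψ θ - Mop n U i ψ θ) := by
  have hU' : ContDiffOn ℝ 1 (fun y k => U k y) (chamber n) := contDiffOn_pi.2 hU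
  have hUθ := hU'.contDiffAt (isOpen_chamber.mem_nhds hθ)
  have hlevel : ∀ x ∈ chamber n, ∀ i, nullHam i x (fun k => U k x) = h + 3 / 2 * ((n : ℝ) - 1) :=
    fun x hx i => nullHam_eq_of_nullVector hx (hnv i x hx)
  have hV : ∀ k, DifferentiableAt ℝ (fun y => velocity k y fun l => U l y) θ := fun k =>
    (contDiffAt_velocity contDiffAt_id hUθ hθ k).differentiableAt one_ne_zero
  have hM : ∀ k, Mop n U k ψ = fun y => fderiv ℝ ψ y (velocity k y fun l => U l y) :=
    fun k => funext (Mop_eq_fderiv_velocity U k ψ)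
  rw [Mop_eq_fderiv_velocity, Mop_eq_fderiv_velocity, hM, hM,
    fderiv_fderiv_apply_sub (hψ.contDiffAt (isOpen_chamber.mem_nhds hθ)) (hV i) (hV j),
    velocity_commutator hU' hlevel hij hθ, one_add_cotHalf_sq (sin_half_sub_ne_zero hθ hij),
    map_smul, map_sub, smul_eq_mul]
end

section
/- Let n ≥ 2 be even, m ≥ 1, let z_1,…,z_n be distinct complex numbers and ξ_1,…,ξ_m distinct nonzero complex numbers with z_j ≠ ξ_l for all j,l. Fix k ∈ {1,…,m} and define, on a neighborhood of ξ_k, T(z) = z^{m−n/2−1}·∏_{j=1}^n (z−z_j)·∏_{l≠k} (z−ξ_l)^{−2} (the exponent m−n/2−1 is an integer since n is even). Set A_k = ξ_k^{m−n/2−1}·∏_{j=1}^n (ξ_k−z_j)/∏_{l≠k}(ξ_k−ξ_l)^2 and B_k = ( Σ_{j=1}^n 1/(ξ_k−z_j) − 2Σ_{l≠k} 1/(ξ_k−ξ_l) − (n/2−m+1)/ξ_k )·A_k. Then T(ξ_k) = A_k, T is differentiable at ξ_k with T'(ξ_k) = B_k, and B_k = 0 if and only if the unit-disk stationary relation at ξ_k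 holds: −Σ_{j=1}^n 2/(ξ_k−z_j) + Σ_{l≠k} 4/(ξ_k−ξ_l) + (n−2m+2)/ξ_k = 0. -/
open Finset

/-- If each factor `f i` has logarithmic derivative `g i` at `x`, the product has logarithmic
derivative `∑ i ∈ s, g i` at `x`. -/
theorem HasDerivAt.finset_prod_of_logDeriv {ι : Type*} (s : Finset ι)
    {f : ι → ℂ → ℂ} {g : ι → ℂ} {x : ℂ}
    (h : ∀ i ∈ s, HasDerivAt (f i) (g i * f i x) x) :
    HasDerivAt (fun w => ∏ i ∈ s, f i w) ((∑ i ∈ s, g i) * ∏ i ∈ s, f i x) x := by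
  classical
  induction s using Finset.induction_on with
  | empty => simpa using hasDerivAt_const x (1 : ℂ)
  | insert a s ha ih =>
    simp only [Finset.prod_insert ha, Finset.sum_insert ha]
    refine ((h a (mem_insert_self a s)).mul
      (ih fun i hi => h i (mem_insert_of_mem hi))).congr_deriv ?_
    ring

/-- The logarithmic derivative of `w ↦ (w - a) ^ p` at `x ≠ a` is `p / (x - a)`. -/
theorem hasDerivAt_sub_zpow_logDeriv (p : ℤ) {a x : ℂ} (hx : x ≠ a) :
    HasDerivAt (fun w => (w - a) ^ p) (p / (x - a) * (x - a) ^ p) x := by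
  have hxa : x - a ≠ 0 := sub_ne_zero.mpr hx
  refine ((hasDerivAt_zpow p (x - a) (Or.inl hxa)).comp_sub_const x a).congr_deriv ?_
  rw [zpow_sub_one₀ hxa]
  ring

theorem stmt18 (n m : ℕ) (hn : 2 ≤ n) (hne : Even n) (hm : 1 ≤ m)
    (z : Fin n → ℂ) (ξ : Fin m → ℂ)
    (hzz : ∀ i j, i ≠ j → z i ≠ z j)
    (hξξ : ∀ k l, k ≠ l → ξ k ≠ ξ l)
    (hξ0 : ∀ l, ξ l ≠ 0)
    (hzξ : ∀ j l, z j ≠ ξ l)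
    (k : Fin m)
    (T : ℂ → ℂ)
    (hT : ∀ w : ℂ, T w =
      w ^ ((m : ℤ) - (n : ℤ) / 2 - 1) * (∏ j, (w - z j)) *
        ∏ l ∈ univ.filter (fun l => l ≠ k), (w - ξ l) ^ (-2 : ℤ))
    (A B : ℂ)
    (hA : A = ξ k ^ ((m : ℤ) - (n : ℤ) / 2 - 1) * (∏ j, (ξ k - z j)) /
        ∏ l ∈ univ.filter (fun l => l ≠ k), (ξ k - ξ l) ^ 2)
    (hB : B = ((∑ j, 1 / (ξ k - z j))
        - 2 * ∑ l ∈ univ.filter (fun l => l ≠ k), 1 / (ξ k - ξ l)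
        - ((n : ℂ) / 2 - (m : ℂ) + 1) / ξ k) * A) :
    T (ξ k) = A ∧ HasDerivAt T B (ξ k) ∧
      (B = 0 ↔
        -(∑ j, 2 / (ξ k - z j))
          + (∑ l ∈ univ.filter (fun l => l ≠ k), 4 / (ξ k - ξ l))
          + ((n : ℂ) - 2 * (m : ℂ) + 2) / ξ k = 0) := by
  have hprod : ∏ l ∈ univ.filter (fun l => l ≠ k), (ξ k - ξ l) ^ (-2 : ℤ) =
      (∏ l ∈ univ.filter (fun l => l ≠ k), (ξ k - ξ l) ^ 2)⁻¹ := by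
    rw [← Finset.prod_inv_distrib]
    refine Finset.prod_congr rfl fun l _ => ?_
    rw [zpow_neg]
    norm_cast
  have hTA : T (ξ k) = A := by rw [hT, hA, hprod, div_eq_mul_inv]
  have hA0 : A ≠ 0 := by
    rw [hA]
    refine div_ne_zero (mul_ne_zero (zpow_ne_zero _ (hξ0 k)) ?_) ?_
    · exact Finset.prod_ne_zero_iff.mpr fun j _ => sub_ne_zero.mpr (hzξ j k).symm
    · refine Finset.prod_ne_zero_iff.mpr fun l hl => pow_ne_zero _ (sub_ne_zero.mpr ?_)
      exact hξξ k l (Finset.mem_filter.mp hl).2.symm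
  refine ⟨hTA, ?_, ?_⟩
  · have hpow := hasDerivAt_sub_zpow_logDeriv ((m : ℤ) - (n : ℤ) / 2 - 1) (hξ0 k)
    simp only [sub_zero] at hpow
    have hzeros := HasDerivAt.finset_prod_of_logDeriv univ
      (f := fun j w => w - z j) (g := fun j => 1 / (ξ k - z j)) (x := ξ k) fun j _ => by
        simpa using hasDerivAt_sub_zpow_logDeriv 1 (hzξ j k).symm
    have hpoles := HasDerivAt.finset_prod_of_logDeriv (univ.filter fun l => l ≠ k)
      (f := fun l w => (w - ξ l) ^ (-2 : ℤ)) (g := fun l => ((-2 : ℤ) : ℂ) / (ξ k - ξ l))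
      (x := ξ k) fun l hl =>
        hasDerivAt_sub_zpow_logDeriv (-2) (hξξ k l (Finset.mem_filter.mp hl).2.symm)
    have hexp : (((m : ℤ) - (n : ℤ) / 2 - 1 : ℤ) : ℂ) = -((n : ℂ) / 2 - (m : ℂ) + 1) := by
      obtain ⟨r, rfl⟩ := hne
      have hr : ((r + r : ℕ) : ℤ) / 2 = r := by omega
      rw [hr]
      push_cast
      ring
    have hsum : ∑ l ∈ univ.filter (fun l => l ≠ k), ((-2 : ℤ) : ℂ) / (ξ k - ξ l) =
        -2 * ∑ l ∈ univ.filter (fun l => l ≠ k), 1 / (ξ k - ξ l) := by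
      rw [Finset.mul_sum]
      refine Finset.sum_congr rfl fun l _ => ?_
      push_cast
      ring
    rw [funext hT]
    refine ((hpow.mul hzeros).mul hpoles).congr_deriv ?_
    rw [hB, ← hTA, hT, hsum, hexp]
    simp only [Pi.mul_apply]
    ring
  · have hrel : -(∑ j, 2 / (ξ k - z j))
          + (∑ l ∈ univ.filter (fun l => l ≠ k), 4 / (ξ k - ξ l))
          + ((n : ℂ) - 2 * (m : ℂ) + 2) / ξ k =
        -2 * ((∑ j, 1 / (ξ k - z j))
          - 2 * ∑ l ∈ univ.filter (fun l => l ≠ k), 1 / (ξ k - ξ l)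
          - ((n : ℂ) / 2 - (m : ℂ) + 1) / ξ k) := by
      have hzeros : ∑ j, 2 / (ξ k - z j) = 2 * ∑ j, 1 / (ξ k - z j) := by
        simp only [Finset.mul_sum, mul_one_div]
      have hpoles : ∑ l ∈ univ.filter (fun l => l ≠ k), 4 / (ξ k - ξ l) =
          4 * ∑ l ∈ univ.filter (fun l => l ≠ k), 1 / (ξ k - ξ l) := by
        simp only [Finset.mul_sum, mul_one_div]
      rw [hzeros, hpoles]
      ring
    rw [hrel, hB]
    simp [hA0]
end
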